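/- Let Λ ∈ ℝ^{d×d} be a symmetric positive semidefinite matrix. For every measurable s : ℝᵈ → ℝᵈ with E_{z₀∼p₀} E_{z_t∼k(·|z₀)}[(∇_{z_t} ln k(z_t|z₀) − s(z_t))ᵀ Λ (∇_{z_t} ln k(z_t|z₀) − s(z_t))] < ∞, one has E_{z_t∼p}[(∇_{z_t} ln p(z_t) − s(z_t))ᵀ Λ (∇_{z_t} ln p(z_t) − s(z_t))] = E_{z₀∼p₀} E_{z_t∼k(·|z₀)}[(∇_{z_t} ln k(z_t|z₀) − s(z_t))ᵀ Λ (∇_{z_t} ln k(z_t|z₀) − s(z_t))] + C, where the constant C does not depend on s. -/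

import Mathlib

open MeasureTheory

noncomputable section

/-- `ℝᵈ` as a Euclidean space. -/
abbrev Euc (d : ℕ) := EuclideanSpace ℝ (Fin d)

/-- Score `∇ ln f` of a positive function `f`. -/
def scoreOf {d : ℕ} (f : Euc d → ℝ) (x : Euc d) : Euc d :=
  gradient (fun u => Real.log (f u)) x

/-- The quadratic form `vᵀ Λ v`. -/
def quadForm {d : ℕ} (Λ : Matrix (Fin d) (Fin d) ℝ) (v : Euc d) : ℝ :=
  ∑ i, ∑ j, Λ i j * v i * v j

/-- Weighted denoising objective
`E_{z₀∼p₀} E_{z_t∼k(·|z₀)}[(∇ ln k(z_t|z₀) − s(z_t))ᵀ Λ (∇ ln k(z_t|z₀) − s(z_t))]`. -/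
def dsmObjQ (d : ℕ) (Λ : Matrix (Fin d) (Fin d) ℝ) (p₀ : Euc d → ℝ)
    (k : Euc d → Euc d → ℝ) (s : Euc d → Euc d) : ℝ :=
  ∫ z : Euc d × Euc d,
    p₀ z.1 * k z.2 z.1 * quadForm Λ (scoreOf (fun u => k u z.1) z.2 - s z.2)

/-- Weighted marginal objective `E_{z_t∼p}[(∇ ln p(z_t) − s(z_t))ᵀ Λ (∇ ln p(z_t) − s(z_t))]`. -/
def smObjQ (d : ℕ) (Λ : Matrix (Fin d) (Fin d) ℝ) (p : Euc d → ℝ) (s : Euc d → Euc d) : ℝ :=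
  ∫ x : Euc d, p x * quadForm Λ (scoreOf p x - s x)

/-- Finiteness of the weighted denoising objective. -/
def dsmFinQ (d : ℕ) (Λ : Matrix (Fin d) (Fin d) ℝ) (p₀ : Euc d → ℝ)
    (k : Euc d → Euc d → ℝ) (s : Euc d → Euc d) : Prop :=
  Integrable (fun z : Euc d × Euc d =>
    p₀ z.1 * k z.2 z.1 * quadForm Λ (scoreOf (fun u => k u z.1) z.2 - s z.2))

open Filter Topology

theorem aux_score {d : ℕ} {f : Euc d → ℝ} {x : Euc d} (hf : DifferentiableAt ℝ f x)
    (hx : 0 < f x) (i : Fin d) :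
    f x * (scoreOf f x) i = fderiv ℝ f x (EuclideanSpace.single i 1) := by
  have h1 : (scoreOf f x) i = fderiv ℝ (fun u => Real.log (f u)) x (EuclideanSpace.single i 1) := by
    unfold scoreOf
    rw [← toDual_gradient, InnerProductSpace.toDual_apply_apply]
    rw [EuclideanSpace.inner_single_right]
    simp only [one_mul, conj_trivial]
  rw [h1, fderiv.log hf hx.ne']
  simp only [smul_apply, smul_eq_mul]
  field_simp

theorem aux_meas_comp {α : Type*} [MeasurableSpace α] {d : ℕ} {s : α → Euc d}
    (hs : Measurable s) (i : Fin d) : Measurable fun x => s x i :=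
  (EuclideanSpace.proj (𝕜 := ℝ) i : Euc d →L[ℝ] ℝ).continuous.measurable.comp hs

theorem aux_meas_fderiv {d : ℕ} (k : Euc d → Euc d → ℝ)
    (hk_meas : Measurable fun z : Euc d × Euc d => k z.1 z.2)
    (hk_diff : ∀ z₀, Differentiable ℝ fun zt => k zt z₀) (v : Euc d) :
    Measurable fun z : Euc d × Euc d => fderiv ℝ (fun u => k u z.1) z.2 v := by
  refine measurable_of_tendsto_metrizable
    (f := fun (n : ℕ) (z : Euc d × Euc d) => (n : ℝ) • (k (z.2 + (n : ℝ)⁻¹ • v) z.1 - k z.2 z.1)) ?_ ?_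
  · intro n
    have h1 : Measurable fun z : Euc d × Euc d => k (z.2 + (n : ℝ)⁻¹ • v) z.1 :=
      hk_meas.comp (g := fun z : Euc d × Euc d => k z.1 z.2)
        (f := fun z : Euc d × Euc d => (z.2 + (n : ℝ)⁻¹ • v, z.1)) (by fun_prop)
    have h2 : Measurable fun z : Euc d × Euc d => k z.2 z.1 :=
      hk_meas.comp (g := fun z : Euc d × Euc d => k z.1 z.2)
        (f := fun z : Euc d × Euc d => (z.2, z.1)) (by fun_prop)
    exact (h1.sub h2).const_smul (n : ℝ)
  · rw [tendsto_pi_nhds]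
    intro z
    refine ((hk_diff z.1) z.2).hasFDerivAt.lim v ?_
    simpa using tendsto_natCast_atTop_atTop (R := ℝ)

/-- bilinear form -/
def auxB {d : ℕ} (Λ : Matrix (Fin d) (Fin d) ℝ) (u v : Euc d) : ℝ :=
  ∑ i, ∑ j, Λ i j * u i * v j

theorem aux_q_sub {d : ℕ} {Λ : Matrix (Fin d) (Fin d) ℝ} (hΛ : Λ.IsSymm) (u v : Euc d) :
    quadForm Λ (u - v) = quadForm Λ u - 2 * auxB Λ u v + quadForm Λ v := by
  have hB : auxB Λ u v = ∑ i, ∑ j, Λ i j * v i * u j := by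
    unfold auxB
    rw [Finset.sum_comm]
    refine Finset.sum_congr rfl fun i _ => Finset.sum_congr rfl fun j _ => ?_
    rw [← hΛ.apply i j]; ring
  have : 2 * auxB Λ u v = ∑ i, ∑ j, (Λ i j * u i * v j + Λ i j * v i * u j) := by
    rw [two_mul]
    nth_rw 2 [hB]
    simp only [auxB, Finset.sum_add_distrib]
  rw [this]
  simp only [quadForm, ← Finset.sum_add_distrib, ← Finset.sum_sub_distrib]
  refine Finset.sum_congr rfl fun i _ => Finset.sum_congr rfl fun j _ => ?_
  simp only [PiLp.sub_apply]; ring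

theorem aux_q_nonneg {d : ℕ} {Λ : Matrix (Fin d) (Fin d) ℝ} (hΛ : Λ.PosSemidef) (v : Euc d) :
    0 ≤ quadForm Λ v := by
  have := hΛ.dotProduct_mulVec_nonneg (fun i => v i)
  simp only [dotProduct, Matrix.mulVec, Finset.mul_sum, star_trivial] at this
  refine this.trans_eq ?_
  unfold quadForm
  refine Finset.sum_congr rfl fun i _ => Finset.sum_congr rfl fun j _ => ?_
  simp; ring

theorem aux_q_le {d : ℕ} {Λ : Matrix (Fin d) (Fin d) ℝ} (hs : Λ.IsSymm) (hΛ : Λ.PosSemidef)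
    (a s : Euc d) : quadForm Λ s ≤ 2 * quadForm Λ a + 2 * quadForm Λ (a - s) := by
  have h := aux_q_nonneg hΛ (a - s - (-a))
  have e := aux_q_sub hs (a - s) (-a)
  have e2 := aux_q_sub hs a (a - s)
  have e3 : a - (a - s) = s := by abel
  have e4 : quadForm Λ (-a) = quadForm Λ a := by
    simp [quadForm]
  have e5 : auxB Λ (a - s) (-a) = - auxB Λ a (a - s) := by
    unfold auxB
    rw [Finset.sum_comm, ← Finset.sum_neg_distrib]
    refine Finset.sum_congr rfl fun i _ => ?_
    rw [← Finset.sum_neg_distrib]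
    refine Finset.sum_congr rfl fun j _ => ?_
    rw [← hs.apply i j]; simp; ring
  rw [e3] at e2
  rw [e, e4, e5] at h
  linarith

theorem aux_meas_q {α : Type*} [MeasurableSpace α] {d : ℕ} (Λ : Matrix (Fin d) (Fin d) ℝ)
    {s : α → Euc d} (hs : ∀ i, Measurable fun x => s x i) :
    Measurable fun x => quadForm Λ (s x) := by
  unfold quadForm
  refine Finset.measurable_sum _ fun i _ => Finset.measurable_sum _ fun j _ => ?_
  exact ((hs i).const_mul _).mul (hs j)

/-- weighted first moment from second -/
theorem aux_int_one {α : Type*} [MeasurableSpace α] {μ : Measure α} {d : ℕ}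
    {w : α → ℝ} (hw0 : ∀ x, 0 ≤ w x) (hw : Integrable w μ) {a : α → Euc d}
    (ha : ∀ i, Measurable fun x => a x i) (h2 : Integrable (fun x => w x * ‖a x‖ ^ 2) μ)
    (i : Fin d) : Integrable (fun x => w x * a x i) μ := by
  refine (hw.add h2).mono' (hw.1.mul (ha i).aestronglyMeasurable) (ae_of_all _ fun x => ?_)
  have h1 : |a x i| ≤ ‖a x‖ := PiLp.norm_apply_le (a x) i
  rw [norm_mul, Real.norm_eq_abs, Real.norm_eq_abs, abs_of_nonneg (hw0 x)]
  simp only [Pi.add_apply]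
  nlinarith [hw0 x, sq_nonneg (‖a x‖ - 1), mul_le_mul_of_nonneg_left
    (show |a x i| ≤ 1 + ‖a x‖ ^ 2 by nlinarith [sq_nonneg (‖a x‖ - 1), norm_nonneg (a x)]) (hw0 x)]

theorem aux_int_q {α : Type*} [MeasurableSpace α] {μ : Measure α} {d : ℕ}
    (Λ : Matrix (Fin d) (Fin d) ℝ)
    {w : α → ℝ} (hw0 : ∀ x, 0 ≤ w x) (hw : Integrable w μ) {a : α → Euc d}
    (ha : ∀ i, Measurable fun x => a x i) (h2 : Integrable (fun x => w x * ‖a x‖ ^ 2) μ) :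
    Integrable (fun x => w x * quadForm Λ (a x)) μ := by
  have h : ∀ i j, Integrable (fun x => w x * (a x i * a x j)) μ := by
    intro i j
    refine h2.mono' (hw.1.mul ((ha i).mul (ha j)).aestronglyMeasurable) (ae_of_all _ fun x => ?_)
    have h1 : |a x i| ≤ ‖a x‖ := PiLp.norm_apply_le (a x) i
    have h1' : |a x j| ≤ ‖a x‖ := PiLp.norm_apply_le (a x) j
    rw [norm_mul, Real.norm_eq_abs, Real.norm_eq_abs, abs_of_nonneg (hw0 x), abs_mul, sq]
    exact mul_le_mul_of_nonneg_left (mul_le_mul h1 h1' (abs_nonneg _) (norm_nonneg _)) (hw0 x)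
  have : (fun x => w x * quadForm Λ (a x))
      = fun x => ∑ i, ∑ j, Λ i j * (w x * (a x i * a x j)) := by
    ext x
    simp only [quadForm, Finset.mul_sum]
    refine Finset.sum_congr rfl fun i _ => Finset.sum_congr rfl fun j _ => ?_
    ring
  rw [this]
  exact integrable_finsetSum _ fun i _ => integrable_finsetSum _ fun j _ => (h i j).const_mul _

/-- derivative under the integral, a.e. -/
theorem aux_key {d : ℕ}
    (p₀ : Euc d → ℝ)
    (k : Euc d → Euc d → ℝ)
    (hk_diff : ∀ z₀, ContDiff ℝ 1 fun zt => k zt z₀)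
    (hk_int : ∀ z₀, Integrable fun zt : Euc d => k zt z₀)
    (p : Euc d → ℝ) (hp : ∀ zt, p zt = ∫ z₀ : Euc d, p₀ z₀ * k zt z₀)
    (hp_diff : Differentiable ℝ p) (v : Euc d)
    (hw : Integrable (fun z : Euc d × Euc d => p₀ z.1 * k z.2 z.1))
    (hp_int : Integrable p)
    (hk' : Integrable (fun z : Euc d × Euc d => p₀ z.1 * fderiv ℝ (fun u => k u z.1) z.2 v))
    (hp' : Integrable (fun x => fderiv ℝ p x v)) :
    ∀ᵐ x : Euc d, fderiv ℝ p x v = ∫ z₀ : Euc d, p₀ z₀ * fderiv ℝ (fun u => k u z₀) x v := by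
  have hG : Integrable (fun x => ∫ z₀ : Euc d, p₀ z₀ * fderiv ℝ (fun u => k u z₀) x v) :=
    hk'.integral_prod_right
  refine ae_eq_of_integral_contDiff_smul_eq hp'.locallyIntegrable hG.locallyIntegrable ?_
  intro g hg hgs
  have hgc : Continuous g := hg.continuous
  have hgd : Differentiable ℝ g := hg.differentiable (by simp)
  have hg'c : Continuous fun x => fderiv ℝ g x v :=
    (hg.continuous_fderiv (by simp)).clm_apply continuous_const
  have hg's : HasCompactSupport fun x => fderiv ℝ g x v := hgs.fderiv_apply ℝ v
  obtain ⟨c, hc⟩ := hgc.bounded_above_of_compact_support hgs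
  obtain ⟨c', hc'⟩ := hg'c.bounded_above_of_compact_support hg's
  simp only [smul_eq_mul]
  have e1 : ∫ x, p x * fderiv ℝ g x v = - ∫ x, fderiv ℝ p x v * g x :=
    integral_mul_fderiv_eq_neg_fderiv_mul_of_integrable
      (hp'.mul_bdd hgc.aestronglyMeasurable (ae_of_all _ hc))
      (hp_int.mul_bdd hg'c.aestronglyMeasurable (ae_of_all _ hc'))
      (hp_int.mul_bdd hgc.aestronglyMeasurable (ae_of_all _ hc))
      (fun x _ => hp_diff x) (fun x _ => hgd x)
  have e2 : ∀ z, ∫ x, k x z * fderiv ℝ g x v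
      = - ∫ x, fderiv ℝ (fun u => k u z) x v * g x := by
    intro z
    refine integral_mul_fderiv_eq_neg_fderiv_mul_of_integrable (f := fun u => k u z)
      ?_
      ((hk_int z).mul_bdd hg'c.aestronglyMeasurable (ae_of_all _ hc'))
      ((hk_int z).mul_bdd hgc.aestronglyMeasurable (ae_of_all _ hc))
      (fun x _ => (hk_diff z).differentiable (by simp) x) (fun x _ => hgd x)
    refine Continuous.integrable_of_hasCompactSupport ?_ hgs.mul_left
    exact (((hk_diff z).continuous_fderiv (by simp)).clm_apply continuous_const).mul hgc
  have i1 : Integrable (fun z : Euc d × Euc d => p₀ z.1 * k z.2 z.1 * fderiv ℝ g z.2 v) :=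
    hw.mul_bdd (hg'c.comp continuous_snd).aestronglyMeasurable (ae_of_all _ fun z => hc' z.2)
  have i2 : Integrable (fun z : Euc d × Euc d =>
      p₀ z.1 * fderiv ℝ (fun u => k u z.1) z.2 v * g z.2) :=
    hk'.mul_bdd (hgc.comp continuous_snd).aestronglyMeasurable (ae_of_all _ fun z => hc z.2)
  calc ∫ x, g x * fderiv ℝ p x v = - ∫ x, p x * fderiv ℝ g x v := by
        rw [e1, neg_neg]; simp only [mul_comm]
    _ = - ∫ x, ∫ z, p₀ z * k x z * fderiv ℝ g x v := by
        congr 1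
        refine integral_congr_ae (ae_of_all _ fun x => ?_)
        simp only
        rw [integral_mul_const, hp]
    _ = - ∫ z, ∫ x, p₀ z * k x z * fderiv ℝ g x v := by
        rw [integral_integral_swap]
        exact i1.swap
    _ = ∫ z, ∫ x, p₀ z * fderiv ℝ (fun u => k u z) x v * g x := by
        rw [← integral_neg]
        refine integral_congr_ae (ae_of_all _ fun z => ?_)
        simp only [mul_assoc]
        rw [integral_const_mul, integral_const_mul, e2]
        ring
    _ = ∫ x, ∫ z, p₀ z * fderiv ℝ (fun u => k u z) x v * g x := by
        rw [integral_integral_swap]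
        exact i2
    _ = _ := by
        refine integral_congr_ae (ae_of_all _ fun x => ?_)
        simp only
        rw [integral_mul_const, mul_comm]

/-- denoising score matching with a positive semidefinite weighting matrix.
For a symmetric positive semidefinite `Λ`, there is a constant `C`, independent of `s`, such
that for every measurable `s` with finite weighted denoising objective,
`E_{z_t∼p}[(∇ ln p − s)ᵀ Λ (∇ ln p − s)] = E_{z₀,z_t}[(∇ ln k − s)ᵀ Λ (∇ ln k − s)] + C`. -/
theorem stmt_9 (d : ℕ) (hd : 1 ≤ d)
    (Λ : Matrix (Fin d) (Fin d) ℝ) (hΛ_symm : Λ.IsSymm) (hΛ_psd : Λ.PosSemidef)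
    (p₀ : Euc d → ℝ) (hp₀_nonneg : ∀ x, 0 ≤ p₀ x) (hp₀_meas : Measurable p₀)
    (hp₀_prob : (∫ x : Euc d, p₀ x) = 1)
    (k : Euc d → Euc d → ℝ)  -- `k zt z₀` is the density `k(z_t | z₀)`
    (hk_meas : Measurable fun z : Euc d × Euc d => k z.1 z.2)
    (hk_pos : ∀ z₀ zt, 0 < k zt z₀)
    (hk_diff : ∀ z₀, ContDiff ℝ 1 fun zt => k zt z₀)
    (hk_prob : ∀ z₀, (∫ zt : Euc d, k zt z₀) = 1)
    (p : Euc d → ℝ) (hp : ∀ zt, p zt = ∫ z₀ : Euc d, p₀ z₀ * k zt z₀)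
    (hp_pos : ∀ zt, 0 < p zt) (hp_diff : Differentiable ℝ p)
    (hfin_k : Integrable (fun z : Euc d × Euc d =>
      p₀ z.1 * k z.2 z.1 * ‖scoreOf (fun u => k u z.1) z.2‖ ^ 2))
    (hfin_p : Integrable (fun x : Euc d => p x * ‖scoreOf p x‖ ^ 2)) :
    ∃ C : ℝ, ∀ s : Euc d → Euc d, Measurable s → dsmFinQ d Λ p₀ k s →
      smObjQ d Λ p s = dsmObjQ d Λ p₀ k s + C := by
  have hk_int : ∀ z₀, Integrable fun zt : Euc d => k zt z₀ := fun z₀ => by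
    by_contra h
    have := hk_prob z₀
    rw [integral_undef h] at this
    exact zero_ne_one this
  have hp₀_int : Integrable p₀ := by
    by_contra h
    rw [integral_undef h] at hp₀_prob
    exact zero_ne_one hp₀_prob
  have hk_d : ∀ z₀, Differentiable ℝ fun zt => k zt z₀ :=
    fun z₀ => (hk_diff z₀).differentiable (by simp)
  have hkm : Measurable fun z : Euc d × Euc d => k z.2 z.1 :=
    hk_meas.comp (g := fun z : Euc d × Euc d => k z.1 z.2)
      (f := fun z : Euc d × Euc d => (z.2, z.1)) (by fun_prop)
  have hwm : Measurable fun z : Euc d × Euc d => p₀ z.1 * k z.2 z.1 :=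
    (hp₀_meas.comp measurable_fst).mul hkm
  have hw0 : ∀ z : Euc d × Euc d, 0 ≤ p₀ z.1 * k z.2 z.1 :=
    fun z => mul_nonneg (hp₀_nonneg _) (hk_pos _ _).le
  have hw : Integrable (fun z : Euc d × Euc d => p₀ z.1 * k z.2 z.1) := by
    refine (integrable_prod_iff hwm.aestronglyMeasurable).2 ⟨?_, ?_⟩
    · exact ae_of_all _ fun z => (hk_int z).const_mul (p₀ z)
    · refine hp₀_int.congr (ae_of_all _ fun z => ?_)
      simp only
      have : ∀ x, ‖p₀ z * k x z‖ = p₀ z * k x z := fun x => by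
        rw [Real.norm_eq_abs, abs_of_nonneg (hw0 (z, x))]
      simp only [this]
      rw [integral_const_mul, hk_prob, mul_one]
  have hp_int : Integrable p := by
    have := hw.integral_prod_right
    refine this.congr (ae_of_all _ fun x => ?_)
    simp only [hp]
  -- scores
  have hka : ∀ i (z : Euc d × Euc d), k z.2 z.1 * (scoreOf (fun u => k u z.1) z.2) i
      = fderiv ℝ (fun u => k u z.1) z.2 (EuclideanSpace.single i 1) :=
    fun i z => aux_score (f := fun u => k u z.1) (hk_d z.1 z.2) (hk_pos _ _) i
  have hpb : ∀ i x, p x * (scoreOf p x) i = fderiv ℝ p x (EuclideanSpace.single i 1) :=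
    fun i x => aux_score (hp_diff x) (hp_pos x) i
  have ham : ∀ i, Measurable fun z : Euc d × Euc d => (scoreOf (fun u => k u z.1) z.2) i := by
    intro i
    have h := (aux_meas_fderiv k hk_meas hk_d (EuclideanSpace.single i 1)).div hkm
    convert h using 2 with z
    simp only [Pi.div_apply]
    rw [← hka i z, mul_div_cancel_left₀ _ (hk_pos _ _).ne']
  have hbm : ∀ i, Measurable fun x => (scoreOf p x) i := by
    intro i
    have h := (measurable_fderiv_apply_const ℝ p (EuclideanSpace.single i (1:ℝ))).div
      hp_diff.continuous.measurable
    convert h using 2 with z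
    simp only [Pi.div_apply]
    rw [← hpb i z, mul_div_cancel_left₀ _ (hp_pos _).ne']
  have ha1 := aux_int_one hw0 hw ham hfin_k
  have hb1 := aux_int_one (fun x => (hp_pos x).le) hp_int hbm hfin_p
  have hqa := aux_int_q Λ hw0 hw ham hfin_k
  have hqb := aux_int_q Λ (fun x => (hp_pos x).le) hp_int hbm hfin_p
  have key : ∀ᵐ x : Euc d, ∀ i, p x * (scoreOf p x) i
      = ∫ z₀ : Euc d, p₀ z₀ * k x z₀ * (scoreOf (fun u => k u z₀) x) i := by
    rw [ae_all_iff]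
    intro i
    have h := aux_key p₀ k hk_diff hk_int p hp hp_diff (EuclideanSpace.single i 1) hw hp_int
      ((ha1 i).congr (ae_of_all _ fun z => by simp only [mul_assoc]; rw [hka]))
      ((hb1 i).congr (ae_of_all _ fun z => hpb i z))
    filter_upwards [h] with x hx
    rw [hpb, hx]
    refine integral_congr_ae (ae_of_all _ fun z => ?_)
    simp only [mul_assoc]
    rw [← hka i (z, x)]
  have haint : ∀ᵐ x : Euc d, ∀ i, Integrable fun z₀ : Euc d =>
      p₀ z₀ * k x z₀ * (scoreOf (fun u => k u z₀) x) i := by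
    rw [ae_all_iff]
    intro i
    exact (ha1 i).prod_left_ae
  refine ⟨(∫ x : Euc d, p x * quadForm Λ (scoreOf p x)) - ∫ z : Euc d × Euc d,
    p₀ z.1 * k z.2 z.1 * quadForm Λ (scoreOf (fun u => k u z.1) z.2), ?_⟩
  intro s hs hfin
  unfold dsmFinQ at hfin
  unfold smObjQ dsmObjQ
  have hsm : Measurable fun z : Euc d × Euc d => quadForm Λ (s z.2) :=
    aux_meas_q Λ fun i => (aux_meas_comp hs i).comp measurable_snd
  have hqs : Integrable fun z : Euc d × Euc d => p₀ z.1 * k z.2 z.1 * quadForm Λ (s z.2) := by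
    refine ((hqa.const_mul 2).add (hfin.const_mul 2)).mono' (hwm.mul hsm).aestronglyMeasurable
      (ae_of_all _ fun z => ?_)
    rw [Real.norm_eq_abs, abs_of_nonneg (mul_nonneg (hw0 z) (aux_q_nonneg hΛ_psd _))]
    have := mul_le_mul_of_nonneg_left
      (aux_q_le hΛ_symm hΛ_psd (scoreOf (fun u => k u z.1) z.2) (s z.2)) (hw0 z)
    simp only [Pi.add_apply]
    linarith
  have hB : Integrable fun z : Euc d × Euc d =>
      p₀ z.1 * k z.2 z.1 * auxB Λ (scoreOf (fun u => k u z.1) z.2) (s z.2) := by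
    refine (((hqa.add hqs).sub hfin).const_mul (1/2)).congr (ae_of_all _ fun z => ?_)
    simp only [Pi.add_apply, Pi.sub_apply]
    rw [aux_q_sub hΛ_symm]; ring
  have eqs : ∀ x, ∫ z₀, p₀ z₀ * k x z₀ * quadForm Λ (s x) = p x * quadForm Λ (s x) := by
    intro x
    rw [integral_mul_const, hp]
  have eB : ∀ᵐ x : Euc d, ∫ z₀, p₀ z₀ * k x z₀ * auxB Λ (scoreOf (fun u => k u z₀) x) (s x)
      = p x * auxB Λ (scoreOf p x) (s x) := by
    filter_upwards [key, haint] with x hx hi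
    have e : ∀ (w : ℝ) (a : Euc d), w * auxB Λ a (s x)
        = ∑ i, ∑ j, (Λ i j * s x j) * (w * a i) := by
      intro w a
      simp only [auxB, Finset.mul_sum]
      refine Finset.sum_congr rfl fun i _ => Finset.sum_congr rfl fun j _ => ?_
      ring
    simp only [e]
    rw [integral_finsetSum _ fun i _ => integrable_finsetSum _ fun j _ => (hi i).const_mul _]
    refine Finset.sum_congr rfl fun i _ => ?_
    rw [integral_finsetSum _ fun j _ => (hi i).const_mul _]
    refine Finset.sum_congr rfl fun j _ => ?_
    rw [integral_const_mul, hx i]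
  have hqs' : Integrable fun x => p x * quadForm Λ (s x) :=
    hqs.integral_prod_right.congr (ae_of_all _ eqs)
  have hB' : Integrable fun x => p x * auxB Λ (scoreOf p x) (s x) :=
    hB.integral_prod_right.congr eB
  have Eqs : ∫ z : Euc d × Euc d, p₀ z.1 * k z.2 z.1 * quadForm Λ (s z.2)
      = ∫ x, p x * quadForm Λ (s x) := by
    rw [Measure.volume_eq_prod, integral_prod_symm _ hqs]
    exact integral_congr_ae (ae_of_all _ eqs)
  have EB : ∫ z : Euc d × Euc d,
      p₀ z.1 * k z.2 z.1 * auxB Λ (scoreOf (fun u => k u z.1) z.2) (s z.2)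
      = ∫ x, p x * auxB Λ (scoreOf p x) (s x) := by
    rw [Measure.volume_eq_prod, integral_prod_symm _ hB]
    exact integral_congr_ae eB
  have L : ∫ x, p x * quadForm Λ (scoreOf p x - s x)
      = (∫ x, p x * quadForm Λ (scoreOf p x)) - 2 * (∫ x, p x * auxB Λ (scoreOf p x) (s x))
        + ∫ x, p x * quadForm Λ (s x) := by
    rw [← integral_const_mul, ← integral_sub hqb (hB'.const_mul 2),
      ← integral_add (f := fun x => p x * quadForm Λ (scoreOf p x) -
        2 * (p x * auxB Λ (scoreOf p x) (s x))) (hqb.sub (hB'.const_mul 2)) hqs']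
    refine integral_congr_ae (ae_of_all _ fun x => ?_)
    simp only [aux_q_sub hΛ_symm]; ring
  have R : ∫ z : Euc d × Euc d,
      p₀ z.1 * k z.2 z.1 * quadForm Λ (scoreOf (fun u => k u z.1) z.2 - s z.2)
      = (∫ z : Euc d × Euc d, p₀ z.1 * k z.2 z.1 * quadForm Λ (scoreOf (fun u => k u z.1) z.2))
        - 2 * (∫ z : Euc d × Euc d,
          p₀ z.1 * k z.2 z.1 * auxB Λ (scoreOf (fun u => k u z.1) z.2) (s z.2))
        + ∫ z : Euc d × Euc d, p₀ z.1 * k z.2 z.1 * quadForm Λ (s z.2) := by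
    rw [← integral_const_mul, ← integral_sub hqa (hB.const_mul 2),
      ← integral_add (f := fun z : Euc d × Euc d =>
        p₀ z.1 * k z.2 z.1 * quadForm Λ (scoreOf (fun u => k u z.1) z.2) -
        2 * (p₀ z.1 * k z.2 z.1 * auxB Λ (scoreOf (fun u => k u z.1) z.2) (s z.2)))
        (hqa.sub (hB.const_mul 2)) hqs]
    refine integral_congr_ae (ae_of_all _ fun x => ?_)
    simp only [aux_q_sub hΛ_symm]; ring
  rw [L, R, Eqs, EB]
  ring

end
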